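/- Let a, b ∈ O₆ with b = a + 3 (mod 6), let n ∈ ℤ, u ∈ O₆, and let γ = +(n,u; a, b, a) − (n,u; b, a, b) be a 3-chain of (O₆, ℤ×O₆). If u = a or u = b, then γ is a 3-cycle and η(π(γ)) = 0. If u ∉ {a, b}, then g(γ) ≠ 0. -/

import Mathlib

namespace QHom

variable {X S : Type*}

/-- Generating tuples: an element of `S` together with a list of quandle elements
whose consecutive entries are distinct. -/
abbrev Gen (X S : Type*) := {p : S × List X // p.2.Chain' (· ≠ ·)}

/-- The chain group: the free abelian group on `Gen X S`. -/
abbrev Ch (X S : Type*) := Gen X S →₀ ℤ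

/-- The basis chain associated to a tuple; `0` if two consecutive entries coincide. -/
noncomputable def gen (s : S) (l : List X) : Ch X S := by
  classical
  exact if h : l.Chain' (· ≠ ·) then Finsupp.single ⟨(s, l), h⟩ 1 else 0

noncomputable def fOn (t : Gen X S) : Ch X S :=
  ∑ j : Fin t.1.2.length, ((-1 : ℤ) ^ ((j : ℕ) + 1)) • gen t.1.1 (t.1.2.eraseIdx (j : ℕ))

/-- The map `f`. -/
noncomputable def fmap (γ : Ch X S) : Ch X S := γ.sum fun t c => c • fOn t

noncomputable def gOn (op : X → X → X) (sact : S → X → S) (t : Gen X S) : Ch X S :=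
  ∑ j : Fin t.1.2.length,
    ((-1 : ℤ) ^ (j : ℕ)) •
      gen (sact t.1.1 (t.1.2.get j))
        ((t.1.2.take (j : ℕ)).map (fun x => op x (t.1.2.get j)) ++ t.1.2.drop ((j : ℕ) + 1))

/-- The map `g`. -/
noncomputable def gmap (op : X → X → X) (sact : S → X → S) (γ : Ch X S) : Ch X S :=
  γ.sum fun t c => c • gOn op sact t

/-- The boundary map `∂ = f + g`. -/
noncomputable def bd (op : X → X → X) (sact : S → X → S) (γ : Ch X S) : Ch X S :=
  fmap γ + gmap op sact γ

/-- `γ` is an `m`-chain: it is supported on tuples of length `m`. -/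
def IsMChain (m : ℕ) (γ : Ch X S) : Prop := ∀ t ∈ γ.support, t.1.2.length = m

/-- The length of a chain: the sum of the absolute values of its coefficients. -/
noncomputable def chainLen (γ : Ch X S) : ℕ := γ.sum fun _ c => c.natAbs

/-- `π` : forget the `S`-coordinate. -/
noncomputable def proj (γ : Ch X S) : Ch X Unit := γ.sum fun t c => c • gen () t.1.2

/-- Evaluation of a cochain (given by its values on generating tuples) on a chain. -/
noncomputable def evalCh {A : Type*} [AddCommGroup A] (θ : List X → A) (δ : Ch X Unit) : A :=
  δ.sum fun t c => c • θ t.1.2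

/-- The action of quandle generators on the `X`-set `ℤ × X`. -/
def zact (op : X → X → X) (s : ℤ × X) (a : X) : ℤ × X := (s.1 + 1, op s.2 a)

/-- `γ` is a 3-term of degree `n` and index `u`. -/
def IsTerm3 (γ : Ch X (ℤ × X)) (n : ℤ) (u : X) : Prop :=
  ∃ ε a b c, (ε = (1 : ℤ) ∨ ε = -1) ∧ a ≠ b ∧ b ≠ c ∧ γ = ε • gen (n, u) [a, b, c]

def Efficient {k : ℕ} (γ : Fin k → Ch X S) : Prop := ∀ i j, i ≠ j → γ i ≠ -γ j

def FConnected {k : ℕ} (γ : Fin k → Ch X S) : Prop :=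
  Efficient γ ∧ (∑ i, fmap (γ i)) = 0 ∧
    ∀ I : Finset (Fin k), I.Nonempty → I ≠ Finset.univ → (∑ i ∈ I, fmap (γ i)) ≠ 0

def GConnected {k : ℕ} (op : X → X → X) (sact : S → X → S) (γ : Fin k → Ch X S) : Prop :=
  Efficient γ ∧ (∑ i, gmap op sact (γ i)) = 0 ∧
    ∀ I : Finset (Fin k), I.Nonempty → I ≠ Finset.univ → (∑ i ∈ I, gmap op sact (γ i)) ≠ 0

/-- `n` is the minimal degree of `γ`. -/
def MinDegree (γ : Ch X (ℤ × X)) (n : ℤ) : Prop :=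
  (∃ t ∈ γ.support, t.1.1.1 = n) ∧ ∀ t ∈ γ.support, n ≤ t.1.1.1

/-- `|T_k(γ)|`: the number of terms (with multiplicity) of `γ` of degree `k`. -/
noncomputable def Tcount (γ : Ch X (ℤ × X)) (k : ℤ) : ℕ :=
  γ.sum fun t c => if t.1.1.1 = k then c.natAbs else 0

def revList (op : X → X → X) : List X → List X
  | [] => []
  | a :: l => l.foldl op a :: revList op l

/-- The reverse of a chain of `(X, ℤ × X)` (a chain of the dual quandle). -/
noncomputable def reverse (op : X → X → X) (γ : Ch X (ℤ × X)) : Ch X (ℤ × X) :=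
  γ.sum fun t c => c • gen (-t.1.1.1, t.1.2.foldl op t.1.1.2) (revList op t.1.2)

/-- The degree-shift automorphism `σ`. -/
noncomputable def sigmaMap (γ : Ch X (ℤ × X)) : Ch X (ℤ × X) :=
  γ.sum fun t c => c • gen (t.1.1.1 + 1, t.1.1.2) t.1.2

/-- `γ` is a 3-term of type `ty` with respect to the operation `op`. -/
def IsTypedTerm (op : X → X → X) (γ : Ch X (ℤ × X)) (ty : ℕ) : Prop :=
  ∃ (ε n : ℤ) (u a b c : X), (ε = 1 ∨ ε = -1) ∧ a ≠ b ∧ b ≠ c ∧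
    γ = ε • gen (n, u) [a, b, c] ∧
    ((ty = 0 ∧ a = c ∧ op a b = c) ∨ (ty = 1 ∧ a = c ∧ op a b ≠ c) ∨
      (ty = 2 ∧ a ≠ c ∧ op a b = c) ∨ (ty = 3 ∧ a ≠ c ∧ op a b ≠ c))

/-- A bigon 3-term `⟨x, y⟩` of degree `n` and index `u`. -/
def IsBigon (n : ℤ) (u x y : X) (δ : Ch X (ℤ × X)) : Prop :=
  δ = gen (n, u) [x, y, x] ∨ δ = gen (n, u) [y, x, y]

/-- The case shapes (A), (B), (C). -/
def Shape (δ : Ch X (ℤ × X)) (n : ℤ) (l : ℕ) : Prop :=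
  (4 ≤ l ∧ l ≤ 7 ∧ Tcount δ n = l) ∨
  (6 ≤ l ∧ l ≤ 7 ∧ Tcount δ n = 2 ∧ Tcount δ (n + 1) = l - 2) ∨
  (6 ≤ l ∧ l ≤ 7 ∧ Tcount δ n = 3 ∧ Tcount δ (n + 1) = l - 3)

/-- A quandle structure on `X`. -/
structure QuandleStr (X : Type*) where
  op : X → X → X
  idem : ∀ a, op a a = a
  bij : ∀ b, Function.Bijective fun a => op a b
  dist : ∀ a b c, op (op a b) c = op (op a c) (op b c)

/-- The dual quandle operation. -/
noncomputable def dualOp (Q : QuandleStr X) : X → X → X :=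
  fun a b => (Equiv.ofBijective (fun x => Q.op x b) (Q.bij b)).symm a

/-- An `X`-set: a set with a right action of the associated group `G(X)`, recorded via its
action of the generators, which is bijective generator-wise and compatible with the
defining relations of `G(X)`. -/
structure QSet (X : Type*) (op : X → X → X) (S : Type*) where
  sact : S → X → S
  bij : ∀ a, Function.Bijective fun s => sact s a
  comm : ∀ s a b, sact (sact s a) b = sact (sact s b) (op a b)

/-- The 7-dihedral quandle operation on `ZMod 7`. -/
def R7op : ZMod 7 → ZMod 7 → ZMod 7 := fun a b => 2 * b - a

def zetaInt (a b c : ℤ) : ℤ := (a - b) * ((b ^ 7 + (2 * c - b) ^ 7 - 2 * c ^ 7) / 7)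

/-- The Mochizuki 3-cocycle on triples. -/
def zetaFun (a b c : ZMod 7) : ZMod 7 := (zetaInt a.val b.val c.val : ℤ)

def zetaL : List (ZMod 7) → ZMod 7
  | [a, b, c] => zetaFun a b c
  | _ => 0

/-- The octahedral quandle operation on `Fin 6`: `octAct a b = σ_b(a)`. -/
def octAct : Fin 6 → Fin 6 → Fin 6 := fun a b =>
  ![![0, 2, 4, 3, 5, 1],
    ![5, 1, 0, 2, 4, 3],
    ![1, 3, 2, 4, 0, 5],
    ![0, 5, 1, 3, 2, 4],
    ![2, 1, 3, 5, 4, 0],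
    ![4, 0, 2, 1, 3, 5]] b a

/-- `σ₀`, the rotation about the axis through `0` and `3`. -/
def sig0 : Fin 6 → Fin 6 := fun a => octAct a 0

def etaTriples1 : List (Fin 6 × Fin 6 × Fin 6) :=
  [(0, 1, 2), (0, 3, 1), (1, 2, 0), (1, 4, 2), (3, 1, 5)]

def etaTriples2 : List (Fin 6 × Fin 6 × Fin 6) :=
  [(0, 1, 5), (1, 0, 1), (1, 0, 5), (1, 2, 1), (1, 3, 1), (1, 3, 2), (1, 4, 5), (1, 5, 1),
    (3, 0, 1), (3, 1, 0), (3, 1, 2)]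

/-- The 3-cocycle `η` of the octahedral quandle, on triples. -/
noncomputable def etaFun (a b c : Fin 6) : ZMod 3 := by
  classical
  exact
    if ∃ k : ℕ, ∃ p ∈ etaTriples1, a = sig0^[k] p.1 ∧ b = sig0^[k] p.2.1 ∧ c = sig0^[k] p.2.2
      then 1
    else if ∃ k : ℕ, ∃ p ∈ etaTriples2, a = sig0^[k] p.1 ∧ b = sig0^[k] p.2.1 ∧ c = sig0^[k] p.2.2
      then 2
    else 0

noncomputable def etaL : List (Fin 6) → ZMod 3
  | [a, b, c] => etaFun a b c
  | _ => 0

/-- The bigon 3-chain `+(n,u;a,b,a) − (n,u;b,a,b)`. -/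
noncomputable def bigonChain (n : ℤ) (u a b : Fin 6) : Ch (Fin 6) (ℤ × Fin 6) :=
  gen (n, u) [a, b, a] - gen (n, u) [b, a, b]

theorem gen_of_isChain {s : S} {l : List X} (h : l.Chain' (· ≠ ·)) :
    gen s l = Finsupp.single (⟨(s, l), h⟩ : Gen X S) 1 := by
  rw [gen, dif_pos h]

theorem gen_of_not_isChain {s : S} {l : List X} (h : ¬ l.Chain' (· ≠ ·)) :
    gen s l = 0 := by
  rw [gen, dif_neg h]

theorem gen_pair_self (s : S) (a : X) : gen s [a, a] = 0 :=
  gen_of_not_isChain (by simp [List.Chain'])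

theorem chain_triple {a b : X} (h : a ≠ b) : [a, b, a].Chain' (· ≠ ·) := by
  simp [List.Chain', h, h.symm]

theorem fOn_triple (s : S) (a b c : X) (h : [a, b, c].Chain' (· ≠ ·)) :
    fOn (⟨(s, [a, b, c]), h⟩ : Gen X S) =
      -gen s [b, c] + gen s [a, c] - gen s [a, b] := by
  change (∑ j : Fin 3, _) = _
  rw [Fin.sum_univ_three]
  simp [List.eraseIdx, sub_eq_add_neg, pow_succ]

theorem gOn_triple (op : X → X → X) (sact : S → X → S) (s : S) (a b c : X)
    (h : [a, b, c].Chain' (· ≠ ·)) :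
    gOn op sact (⟨(s, [a, b, c]), h⟩ : Gen X S) =
      gen (sact s a) [b, c] - gen (sact s b) [op a b, c] +
        gen (sact s c) [op a c, op b c] := by
  change (∑ j : Fin 3, _) = _
  rw [Fin.sum_univ_three]
  simp [sub_eq_add_neg]

/-- The linear extension of `F`, evaluated at a difference of two basis chains. -/
theorem sum_smul_gen_sub {M : Type*} [AddCommGroup M] (F : Gen X S → M) (s : S) {l l' : List X}
    (h : l.Chain' (· ≠ ·)) (h' : l'.Chain' (· ≠ ·)) :
    ((gen s l - gen s l' : Ch X S).sum fun t c => c • F t) =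
      F ⟨(s, l), h⟩ - F ⟨(s, l'), h'⟩ := by
  rw [gen_of_isChain h, gen_of_isChain h',
    Finsupp.sum_sub_index fun _ _ _ => sub_smul _ _ _]
  simp

theorem fmap_bigonChain (n : ℤ) (u : Fin 6) {a b : Fin 6} (h : a ≠ b) :
    fmap (bigonChain n u a b) = 0 := by
  rw [fmap, bigonChain, sum_smul_gen_sub _ _ (chain_triple h) (chain_triple h.symm),
    fOn_triple, fOn_triple, gen_pair_self, gen_pair_self]
  abel

theorem octAct_self (a : Fin 6) : octAct a a = a := by
  revert a; decide

theorem octAct_antipode (a : Fin 6) : octAct a (a + 3) = a := by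
  revert a; decide

theorem octAct_antipode_left (a : Fin 6) : octAct (a + 3) a = a + 3 := by
  revert a; decide

theorem ne_antipode (a : Fin 6) : a ≠ a + 3 := by
  revert a; decide

theorem octAct_ne_octAct_antipode {u a : Fin 6} (h : u ≠ a) (h' : u ≠ a + 3) :
    octAct u a ≠ octAct u (a + 3) := by
  revert u a; decide

theorem gmap_bigonChain_antipode (n : ℤ) (u a : Fin 6) :
    gmap octAct (zact octAct) (bigonChain n u a (a + 3)) =
      (gen (n + 1, octAct u a) [a + 3, a] + gen (n + 1, octAct u a) [a, a + 3]) -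
      (gen (n + 1, octAct u (a + 3)) [a, a + 3] +
        gen (n + 1, octAct u (a + 3)) [a + 3, a]) := by
  have h := ne_antipode a
  rw [gmap, bigonChain, sum_smul_gen_sub _ _ (chain_triple h) (chain_triple h.symm),
    gOn_triple, gOn_triple]
  simp only [octAct_self, octAct_antipode, octAct_antipode_left, gen_pair_self, zact, sub_zero]

theorem sig0_iterate_add_three (k : ℕ) (x : Fin 6) : sig0^[k] (x + 3) = sig0^[k] x + 3 :=
  Function.Commute.iterate_left (f := sig0) (g := (· + 3))
    (by unfold Function.Commute Function.Semiconj; decide) k x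

theorem sig0_iterate_injective (k : ℕ) : Function.Injective sig0^[k] :=
  Function.Injective.iterate (by decide) k

theorem etaFun_antipode (a : Fin 6) : etaFun a (a + 3) a = 0 := by
  have key : ∀ (L : List (Fin 6 × Fin 6 × Fin 6)),
      (∀ p ∈ L, ¬ (p.1 = p.2.2 ∧ p.2.1 = p.1 + 3)) →
      ¬ ∃ k : ℕ, ∃ p ∈ L, a = sig0^[k] p.1 ∧ a + 3 = sig0^[k] p.2.1 ∧ a = sig0^[k] p.2.2 := by
    rintro L hL ⟨k, p, hp, h₁, h₂, h₃⟩
    refine hL p hp ⟨sig0_iterate_injective k (h₁.symm.trans h₃), sig0_iterate_injective k ?_⟩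
    rw [sig0_iterate_add_three, ← h₁, h₂]
  rw [etaFun, if_neg (key etaTriples1 (by simp [etaTriples1])),
    if_neg (key etaTriples2 (by simp [etaTriples2]))]

theorem etaFun_antipode_left (a : Fin 6) : etaFun (a + 3) a (a + 3) = 0 := by
  have h : a + 3 + 3 = a := by revert a; decide
  simpa only [h] using etaFun_antipode (a + 3)

/-- the antipodal bigon chain in `O₆`. -/
theorem antipodal_bigon (a b : Fin 6) (hb : b = a + 3) (n : ℤ) (u : Fin 6) :
    ((u = a ∨ u = b) →
      IsMChain 3 (bigonChain n u a b) ∧ bd octAct (zact octAct) (bigonChain n u a b) = 0 ∧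
        evalCh etaL (proj (bigonChain n u a b)) = 0) ∧
    (u ≠ a ∧ u ≠ b → gmap octAct (zact octAct) (bigonChain n u a b) ≠ 0) := by
  subst hb
  have h := ne_antipode a
  refine ⟨fun hu => ⟨?_, ?_, ?_⟩, fun hu hg => ?_⟩
  · intro t ht
    rw [bigonChain, gen_of_isChain (chain_triple h), gen_of_isChain (chain_triple h.symm)] at ht
    rcases Finset.mem_union.mp (Finsupp.support_sub ht) with ht | ht <;>
      rw [Finset.mem_singleton.mp (Finsupp.support_single_subset ht)] <;> rfl
  · have hact : octAct u (a + 3) = octAct u a := by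
      rcases hu with rfl | rfl
      · rw [octAct_antipode, octAct_self]
      · rw [octAct_self, octAct_antipode_left]
    rw [bd, fmap_bigonChain n u h, gmap_bigonChain_antipode, hact]
    abel
  · rw [proj, bigonChain, sum_smul_gen_sub _ _ (chain_triple h) (chain_triple h.symm),
      evalCh, sum_smul_gen_sub _ _ (chain_triple h) (chain_triple h.symm)]
    simp only [etaL, etaFun_antipode, etaFun_antipode_left, sub_zero]
  · have hact := octAct_ne_octAct_antipode hu.1 hu.2
    have hc : [a, a + 3].Chain' (· ≠ ·) := by simp [List.Chain', h]
    have hc' : [a + 3, a].Chain' (· ≠ ·) := by simp [List.Chain', h.symm]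
    rw [gmap_bigonChain_antipode, gen_of_isChain hc, gen_of_isChain hc', gen_of_isChain hc,
      gen_of_isChain hc'] at hg
    have hg := DFunLike.congr_fun hg ⟨((n + 1, octAct u a), [a, a + 3]), hc⟩
    simp [h, h.symm, hact.symm] at hg

end QHom
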